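/- Let K be a nonempty finite set, c : K → ℝ, and d > 0. Define G(q) = ∑_{k ∈ K} q_k (log q_k − 1 + c_k) on the set D = {q ∈ ℝ^K : q_k ≥ 0 for all k and ∑_{k ∈ K} q_k = d}, with the convention 0 · (log 0 − 1 + c_k) = 0. Then the point q* given by q*_k = d · exp(−c_k) / ∑_{j ∈ K} exp(−c_j) lies in D, is strictly positive in every coordinate, and is the unique minimizer of G over D. -/

import Mathlib

open InformationTheory in
/-- The entropy term at `q`, with linear coefficient `l - log p`, is a relative-entropy term
plus an affine function of `q`. -/
lemma mul_log_sub_one_add_eq_mul_klFun {p q : ℝ} (hp : 0 < p) (hq : 0 ≤ q) (l : ℝ) :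
    q * (Real.log q - 1 + (l - Real.log p)) = p * klFun (q / p) + (q * l - p) := by
  rcases hq.eq_or_lt with rfl | hq
  · simp [klFun_zero]
  · rw [klFun_apply, Real.log_div hq.ne' hp.ne']
    field_simp
    ring

/-- Logit facility-choice condition. On the simplex-type set
`D = {q : q ≥ 0, ∑ q = d}` with `d > 0`, the function
`G(q) = ∑ k, q k * (log (q k) - 1 + c k)` (with the convention
`0 * (log 0 - 1 + c k) = 0`, automatic since `Real.log 0 = 0`) has the unique
minimizer `q*` given by `q* k = d * exp (-c k) / ∑ j, exp (-c j)`, which lies in `D`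
and is strictly positive in every coordinate. -/
theorem logit_unique_minimizer
    (K : Type*) [Fintype K] [Nonempty K] (c : K → ℝ) (d : ℝ) (hd : 0 < d) :
    let D : Set (K → ℝ) := {q | (∀ k, 0 ≤ q k) ∧ ∑ k : K, q k = d}
    let G : (K → ℝ) → ℝ := fun q => ∑ k : K, q k * (Real.log (q k) - 1 + c k)
    let qstar : K → ℝ := fun k => d * Real.exp (-c k) / ∑ j : K, Real.exp (-c j)
    qstar ∈ D ∧ (∀ k, 0 < qstar k) ∧
      (∀ q ∈ D, G qstar ≤ G q) ∧ (∀ q ∈ D, G q = G qstar → q = qstar) := by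
  intro D G qstar
  have hZ : 0 < ∑ j : K, Real.exp (-c j) :=
    Finset.sum_pos (fun j _ => Real.exp_pos _) Finset.univ_nonempty
  have hpos (k) : 0 < qstar k := div_pos (mul_pos hd (Real.exp_pos _)) hZ
  have hmem : qstar ∈ D := by
    refine ⟨fun k => (hpos k).le, ?_⟩
    simp only [qstar]
    rw [← Finset.sum_div, ← Finset.mul_sum, mul_div_assoc, div_self hZ.ne', mul_one]
  set l := Real.log d - Real.log (∑ j : K, Real.exp (-c j))
  have hc (k) : c k = l - Real.log (qstar k) := by
    simp only [qstar]
    rw [Real.log_div (mul_pos hd (Real.exp_pos _)).ne' hZ.ne',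
      Real.log_mul hd.ne' (Real.exp_pos _).ne', Real.log_exp]
    ring
  have hG : ∀ q ∈ D, G q =
      ∑ k, qstar k * InformationTheory.klFun (q k / qstar k) + (d * l - d) := by
    intro q hq
    calc G q = ∑ k, (qstar k * InformationTheory.klFun (q k / qstar k) +
          (q k * l - qstar k)) := Finset.sum_congr rfl fun k _ => by
            rw [hc k, mul_log_sub_one_add_eq_mul_klFun (hpos k) (hq.1 k)]
      _ = _ := by
        rw [Finset.sum_add_distrib, Finset.sum_sub_distrib, ← Finset.sum_mul, hq.2, hmem.2]
  have hGstar : G qstar = d * l - d := by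
    simp [hG qstar hmem, div_self (hpos _).ne', InformationTheory.klFun_one]
  have hnonneg : ∀ q ∈ D, ∀ k, 0 ≤ qstar k * InformationTheory.klFun (q k / qstar k) :=
    fun q hq k => mul_nonneg (hpos k).le
      (InformationTheory.klFun_nonneg (div_nonneg (hq.1 k) (hpos k).le))
  refine ⟨hmem, hpos, fun q hq => ?_, fun q hq h => funext fun k => ?_⟩
  · rw [hGstar, hG q hq]
    exact le_add_of_nonneg_left (Finset.sum_nonneg fun k _ => hnonneg q hq k)
  · rw [hGstar, hG q hq, add_eq_right,
      Finset.sum_eq_zero_iff_of_nonneg fun k _ => hnonneg q hq k] at h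
    have hk := (mul_eq_zero.mp (h k (Finset.mem_univ k))).resolve_left (hpos k).ne'
    rw [InformationTheory.klFun_eq_zero_iff (div_nonneg (hq.1 k) (hpos k).le)] at hk
    exact (div_eq_one_iff_eq (hpos k).ne').mp hk
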